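/- For any function m̂ : E → ℝ obtained as e ↦ inf_{m∈M} ∑_s e_s m(d_s) and any choice of near-optimal couplings, the weak minimax inequality holds: sup_{e∈E} inf_{m∈M} ∑_s e_s m(d_s) = inf_{m∈M} sup_{e∈E} ∑_s e_s m(d_s). (Equality, not just the trivial ≤ direction, using that for each ε > 0 and e ∈ E there is m'_{e,ε} ∈ M with inf_m ∑_s e_s m(d_s) + ε ≥ ∑_s e_s m'_{e,ε}(d_s).) -/

import Mathlib

open MeasureTheory

section Defs
variable {S : Type*} {Xs : S → Type*} [∀ s, MetricSpace (Xs s)]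

/-- membership in E: nonnegative, summable weights with total mass at most 1 -/
def inE (e : S → ℝ) : Prop := (∀ s, 0 ≤ e s) ∧ Summable e ∧ ∑' s, e s ≤ 1

/-- the coordinate semi-metric d_s on the product, as a function on pairs -/
def dd (s : S) (p : (∀ t, Xs t) × (∀ t, Xs t)) : ℝ := dist (p.1 s) (p.2 s)

/-- the cost c_e(x,y) = ∑_s e_s d_s(x_s,y_s) -/
noncomputable def ce (e : S → ℝ) (x y : ∀ s, Xs s) : ℝ := ∑' s, e s * dist (x s) (y s)

/-- the partial Lipschitz constant Δ_s(f) -/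
noncomputable def Delta (f : (∀ s, Xs s) → ℝ) (s : S) : ℝ :=
  sSup {r | ∃ x y : ∀ t, Xs t, (∀ t, t ≠ s → x t = y t) ∧ x ≠ y ∧
    r = (f x - f y) / dist (x s) (y s)}

/-- the Dobrushin semi-norm ‖f‖ = ∑_s Δ_s(f) -/
noncomputable def dobNorm (f : (∀ s, Xs s) → ℝ) : ℝ := ∑' s, Delta f s

variable [∀ s, MeasurableSpace (Xs s)]

/-- m is a coupling (joining) of μ and ν -/
def IsCoupling (μ ν : Measure (∀ s, Xs s)) (m : Measure ((∀ t, Xs t) × (∀ t, Xs t))) : Prop :=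
  m.map Prod.fst = μ ∧ m.map Prod.snd = ν

/-- the Dobrushin distance -/
noncomputable def Dob (μ ν : Measure (∀ s, Xs s)) : ℝ :=
  sSup {r | ∃ f : (∀ s, Xs s) → ℝ, Continuous f ∧ Summable (Delta f) ∧
    (∃ x y, f x ≠ f y) ∧ r = ((∫ x, f x ∂μ) - ∫ x, f x ∂ν) / dobNorm f}

/-- the Steif distance -/
noncomputable def Steif (μ ν : Measure (∀ s, Xs s)) : ℝ :=
  sInf {r | ∃ m : Measure ((∀ t, Xs t) × (∀ t, Xs t)), IsProbabilityMeasure m ∧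
    IsCoupling μ ν m ∧ r = ⨆ s, ∫ p, dd s p ∂m}

end Defs

theorem hasSum_dual_pi {S : Type*} [DecidableEq S] (f : StrongDual ℝ (S → ℝ)) (v : S → ℝ) :
    HasSum (fun s => f (Pi.single s 1) * v s) (f v) := by
  have hv : HasSum (fun s => v s • (Pi.single s 1 : S → ℝ)) v := by
    rw [Pi.hasSum]
    intro t
    convert hasSum_ite_eq t (v t) using 2 with s
    by_cases hst : s = t
    · subst hst; simp
    · simp [hst, Ne.symm hst]
  simpa [mul_comm] using hv.mapL f

theorem exists_forall_le_of_weighted_averages {S : Type*} {K : Set (S → ℝ)} (hne : K.Nonempty)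
    (hcomp : IsCompact K) (hconv : Convex ℝ K) {c : ℝ}
    (h : ∀ e : S → ℝ, inE e → ∀ b, c < b → ∃ v ∈ K, ∑' s, e s * v s < b) :
    ∃ v ∈ K, ∀ s, v s ≤ c := by
  classical
  by_contra! hno
  have hdisj : Disjoint K (Set.Iic fun _ => c) := by
    rw [Set.disjoint_left]
    intro v hv hvc
    obtain ⟨s, hs⟩ := hno v hv
    exact (hvc s).not_gt hs
  obtain ⟨f, u, w, hfK, huw, hfD⟩ :=
    geometric_hahn_banach_compact_closed hconv hcomp (convex_Iic _) isClosed_Iic hdisj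
  set a : S → ℝ := fun s => f (Pi.single s 1)
  have hsum : ∀ v, HasSum (fun s => a s * v s) (f v) := hasSum_dual_pi f
  have ha_nonpos : ∀ s, a s ≤ 0 := by
    intro s
    by_contra! hs
    have hw := hfD _ (Set.mem_Iic.2 (le_refl (fun _ : S => c)))
    have ht : 0 ≤ (f (fun _ => c) - w) / a s := div_nonneg (by linarith) hs.le
    have hmem : (fun _ => c) - ((f (fun _ => c) - w) / a s) • (Pi.single s 1 : S → ℝ) ∈
        Set.Iic (fun _ : S => c) := by
      rw [Set.mem_Iic, sub_le_self_iff]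
      exact smul_nonneg ht (Pi.single_nonneg.2 zero_le_one)
    have hlt := hfD _ hmem
    rw [map_sub, map_smul, smul_eq_mul] at hlt
    change w < f (fun _ => c) - (f (fun _ => c) - w) / a s * a s at hlt
    rw [div_mul_cancel₀ _ hs.ne'] at hlt
    linarith
  have hone : HasSum a (f 1) := by simpa using hsum 1
  have hfc : f (fun _ => c) = c * f 1 := by
    rw [← smul_eq_mul, ← map_smul]
    congr 1
    ext
    simp
  have hneg : f 1 < 0 := by
    refine lt_of_le_of_ne (hone.nonpos ha_nonpos) fun h0 => ?_
    have hzero : a = 0 := by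
      have h0' : HasSum (fun s => -a s) 0 := by simpa [h0] using hone.neg
      ext s
      simpa using congrFun
        ((hasSum_zero_iff_of_nonneg fun s => neg_nonneg.2 (ha_nonpos s)).1 h0') s
    obtain ⟨v, hv⟩ := hne
    have hv0 : f v = 0 := (hsum v).unique (by simp [hzero])
    have h1 := hfK v hv
    have h2 := hfD _ (Set.mem_Iic.2 (le_refl (fun _ : S => c)))
    rw [hfc, h0] at h2
    linarith
  have he : HasSum (fun s => a s / f 1) 1 := by
    simpa [div_self hneg.ne] using hone.div_const (f 1)
  have hw := hfD _ (Set.mem_Iic.2 (le_refl (fun _ : S => c)))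
  obtain ⟨v, hv, hlt⟩ := h (fun s => a s / f 1)
    ⟨fun s => div_nonneg_of_nonpos (ha_nonpos s) hneg.le, he.summable, he.tsum_eq.le⟩
    (u / f 1) (by rw [lt_div_iff_of_neg hneg]; linarith)
  have hval : ∑' s, a s / f 1 * v s = f v / f 1 := by
    rw [← ((hsum v).div_const (f 1)).tsum_eq]
    exact tsum_congr fun s => by ring
  rw [hval, div_lt_div_right_of_neg hneg] at hlt
  exact (hfK v hv).not_gt hlt

theorem isCompact_setOf_isCoupling {S : Type*} [Countable S] {Xs : S → Type*}
    [∀ s, MetricSpace (Xs s)] [∀ s, PolishSpace (Xs s)] [∀ s, MeasurableSpace (Xs s)]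
    [∀ s, BorelSpace (Xs s)] (μ ν : Measure (∀ s, Xs s))
    [IsProbabilityMeasure μ] [IsProbabilityMeasure ν] :
    IsCompact {m : ProbabilityMeasure ((∀ t, Xs t) × (∀ t, Xs t)) |
      IsCoupling μ ν (m : Measure ((∀ t, Xs t) × (∀ t, Xs t)))} := by
  set M := {m : ProbabilityMeasure ((∀ t, Xs t) × (∀ t, Xs t)) |
    IsCoupling μ ν (m : Measure ((∀ t, Xs t) × (∀ t, Xs t)))}
  have hclosed : IsClosed M := by
    let μ' : ProbabilityMeasure (∀ s, Xs s) := ⟨μ, inferInstance⟩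
    let ν' : ProbabilityMeasure (∀ s, Xs s) := ⟨ν, inferInstance⟩
    have hEq : M = {m | m.map continuous_fst.measurable.aemeasurable = μ'} ∩
        {m | m.map continuous_snd.measurable.aemeasurable = ν'} := by
      ext m
      exact and_congr (Subtype.ext_iff (a1 := m.map _) (a2 := μ')).symm
        (Subtype.ext_iff (a1 := m.map _) (a2 := ν')).symm
    rw [hEq]
    exact (isClosed_eq (ProbabilityMeasure.continuous_map continuous_fst) continuous_const).inter
      (isClosed_eq (ProbabilityMeasure.continuous_map continuous_snd) continuous_const)
  rw [← hclosed.closure_eq]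
  apply isCompact_closure_of_isTightMeasureSet
  apply IsTightMeasureSet.prodMk
  · refine (isTightMeasureSet_singleton (μ := μ)).subset ?_
    rintro _ ⟨_, ⟨m, hm, rfl⟩, rfl⟩
    exact hm.1
  · refine (isTightMeasureSet_singleton (μ := ν)).subset ?_
    rintro _ ⟨_, ⟨m, hm, rfl⟩, rfl⟩
    exact hm.2

theorem continuous_dd {S : Type*} {Xs : S → Type*} [∀ s, MetricSpace (Xs s)] (s : S) :
    Continuous (dd (Xs := Xs) s) := by
  unfold dd
  fun_prop

theorem integrable_dd {S : Type*} [Countable S] {Xs : S → Type*}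
    [∀ s, MetricSpace (Xs s)] [∀ s, PolishSpace (Xs s)] [∀ s, MeasurableSpace (Xs s)]
    [∀ s, BorelSpace (Xs s)] {C : ℝ} (hC : ∀ s, ∀ a b : Xs s, dist a b ≤ C) (s : S)
    (m : Measure ((∀ t, Xs t) × (∀ t, Xs t))) [IsFiniteMeasure m] :
    Integrable (dd s) m := by
  refine Integrable.of_bound (continuous_dd s).aestronglyMeasurable C (.of_forall fun p => ?_)
  rw [dd, Real.norm_of_nonneg dist_nonneg]
  exact hC s _ _

theorem isCompact_image_integral_dd {S : Type*} [Countable S] {Xs : S → Type*}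
    [∀ s, MetricSpace (Xs s)] [∀ s, PolishSpace (Xs s)] [∀ s, MeasurableSpace (Xs s)]
    [∀ s, BorelSpace (Xs s)] {C : ℝ} (hC : ∀ s, ∀ a b : Xs s, dist a b ≤ C)
    (μ ν : Measure (∀ s, Xs s)) [IsProbabilityMeasure μ] [IsProbabilityMeasure ν] :
    IsCompact {v : S → ℝ | ∃ m : Measure ((∀ t, Xs t) × (∀ t, Xs t)),
      IsProbabilityMeasure m ∧ IsCoupling μ ν m ∧ v = fun s => ∫ p, dd s p ∂m} := by
  have hcont : Continuous fun (m : ProbabilityMeasure ((∀ t, Xs t) × (∀ t, Xs t))) (s : S) =>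
      ∫ p, dd s p ∂(m : Measure ((∀ t, Xs t) × (∀ t, Xs t))) :=
    continuous_pi fun s => ProbabilityMeasure.continuous_integral_boundedContinuousFunction
      (BoundedContinuousFunction.ofNormedAddCommGroup (dd s) (continuous_dd s) C fun p => by
        rw [dd, Real.norm_of_nonneg dist_nonneg]
        exact hC s _ _)
  convert (isCompact_setOf_isCoupling μ ν).image hcont using 1
  ext v
  constructor
  · rintro ⟨m, hm, hmc, rfl⟩
    exact ⟨⟨m, hm⟩, hmc, rfl⟩
  · rintro ⟨m, hmc, rfl⟩
    exact ⟨m, inferInstance, hmc, rfl⟩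

theorem convex_image_integral_dd {S : Type*} [Countable S] {Xs : S → Type*}
    [∀ s, MetricSpace (Xs s)] [∀ s, PolishSpace (Xs s)] [∀ s, MeasurableSpace (Xs s)]
    [∀ s, BorelSpace (Xs s)] {C : ℝ} (hC : ∀ s, ∀ a b : Xs s, dist a b ≤ C)
    (μ ν : Measure (∀ s, Xs s)) :
    Convex ℝ {v : S → ℝ | ∃ m : Measure ((∀ t, Xs t) × (∀ t, Xs t)),
      IsProbabilityMeasure m ∧ IsCoupling μ ν m ∧ v = fun s => ∫ p, dd s p ∂m} := by
  rintro _ ⟨m, hm, hmc, rfl⟩ _ ⟨n, hn, hnc, rfl⟩ a b ha hb hab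
  have hab' : ENNReal.ofReal a + ENNReal.ofReal b = 1 := by
    rw [← ENNReal.ofReal_add ha hb, hab, ENNReal.ofReal_one]
  refine ⟨ENNReal.ofReal a • m + ENNReal.ofReal b • n, ⟨by simp [hab']⟩, ⟨?_, ?_⟩, ?_⟩
  · rw [Measure.map_add _ _ measurable_fst, Measure.map_smul, Measure.map_smul, hmc.1, hnc.1,
      ← add_smul, hab', one_smul]
  · rw [Measure.map_add _ _ measurable_snd, Measure.map_smul, Measure.map_smul, hmc.2, hnc.2,
      ← add_smul, hab', one_smul]
  · ext s
    rw [integral_add_measure ((integrable_dd hC s m).smul_measure ENNReal.ofReal_ne_top)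
      ((integrable_dd hC s n).smul_measure ENNReal.ofReal_ne_top), integral_smul_measure,
      integral_smul_measure, ENNReal.toReal_ofReal ha, ENNReal.toReal_ofReal hb]
    rfl

theorem isCoupling_prod {S : Type*} {Xs : S → Type*} [∀ s, MeasurableSpace (Xs s)]
    (μ ν : Measure (∀ s, Xs s)) [IsProbabilityMeasure μ] [IsProbabilityMeasure ν] :
    IsCoupling μ ν (μ.prod ν) := by
  constructor <;> simp [Measure.map_fst_prod, Measure.map_snd_prod]

theorem inE.tsum_mul_le {S : Type*} {e v : S → ℝ} {b : ℝ} (he : inE e) (hb : 0 ≤ b)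
    (hv : ∀ s, 0 ≤ v s) (hvb : ∀ s, v s ≤ b) : ∑' s, e s * v s ≤ b := by
  have hle : ∀ s, e s * v s ≤ e s * b := fun s => mul_le_mul_of_nonneg_left (hvb s) (he.1 s)
  have hsum : Summable fun s => e s * b := he.2.1.mul_right b
  calc ∑' s, e s * v s ≤ ∑' s, e s * b :=
        (hsum.of_nonneg_of_le (fun s => mul_nonneg (he.1 s) (hv s)) hle).tsum_le_tsum hle hsum
    _ = (∑' s, e s) * b := tsum_mul_right
    _ ≤ b := mul_le_of_le_one_left hb he.2.2

theorem stmt17 {S : Type*} [Countable S] {Xs : S → Type*} [∀ s, MetricSpace (Xs s)]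
    [∀ s, PolishSpace (Xs s)] [∀ s, MeasurableSpace (Xs s)] [∀ s, BorelSpace (Xs s)]
    (C : ℝ) (hC : ∀ s, ∀ a b : Xs s, dist a b ≤ C)
    (μ ν : Measure (∀ s, Xs s)) [IsProbabilityMeasure μ] [IsProbabilityMeasure ν] :
    sSup {r | ∃ e : S → ℝ, inE e ∧
        r = sInf {t | ∃ m : Measure ((∀ t, Xs t) × (∀ t, Xs t)),
          IsProbabilityMeasure m ∧ IsCoupling μ ν m ∧ t = ∑' s, e s * ∫ p, dd s p ∂m}} =
      sInf {t | ∃ m : Measure ((∀ t, Xs t) × (∀ t, Xs t)),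
        IsProbabilityMeasure m ∧ IsCoupling μ ν m ∧ t = ⨆ s, ∫ p, dd s p ∂m} := by
  have hne : IsProbabilityMeasure (μ.prod ν) ∧ IsCoupling μ ν (μ.prod ν) :=
    ⟨inferInstance, isCoupling_prod μ ν⟩
  have hnn : ∀ (m : Measure ((∀ t, Xs t) × (∀ t, Xs t))) (s : S), 0 ≤ ∫ p, dd s p ∂m :=
    fun m s => integral_nonneg fun p => dist_nonneg
  have hbdd : ∀ m : Measure ((∀ t, Xs t) × (∀ t, Xs t)), IsProbabilityMeasure m →
      BddAbove (Set.range fun s => ∫ p, dd s p ∂m) := by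
    rintro m hm
    refine ⟨C, ?_⟩
    rintro _ ⟨s, rfl⟩
    calc ∫ p, dd s p ∂m ≤ ∫ _, C ∂m :=
          integral_mono (integrable_dd hC s m) (integrable_const C) fun p => hC s _ _
      _ = C := by simp
  have hweak : ∀ e : S → ℝ, inE e → ∀ m : Measure ((∀ t, Xs t) × (∀ t, Xs t)),
      IsProbabilityMeasure m → IsCoupling μ ν m →
      sInf {t | ∃ m : Measure ((∀ t, Xs t) × (∀ t, Xs t)),
        IsProbabilityMeasure m ∧ IsCoupling μ ν m ∧ t = ∑' s, e s * ∫ p, dd s p ∂m} ≤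
      ⨆ s, ∫ p, dd s p ∂m := by
    intro e he m hm hmc
    refine le_trans (csInf_le ⟨0, ?_⟩ ⟨m, hm, hmc, rfl⟩)
      (he.tsum_mul_le (Real.iSup_nonneg (hnn m)) (hnn m) fun s => le_ciSup (hbdd m hm) s)
    rintro _ ⟨n, -, -, rfl⟩
    exact tsum_nonneg fun s => mul_nonneg (he.1 s) (hnn n s)
  have hzero : inE (0 : S → ℝ) := ⟨fun _ => le_rfl, summable_zero, by simp⟩
  apply le_antisymm
  · refine csSup_le ⟨_, 0, hzero, rfl⟩ ?_
    rintro _ ⟨e, he, rfl⟩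
    refine le_csInf ⟨_, _, hne.1, hne.2, rfl⟩ ?_
    rintro _ ⟨m, hm, hmc, rfl⟩
    exact hweak e he m hm hmc
  · set c := sSup {r | ∃ e : S → ℝ, inE e ∧
      r = sInf {t | ∃ m : Measure ((∀ t, Xs t) × (∀ t, Xs t)),
        IsProbabilityMeasure m ∧ IsCoupling μ ν m ∧ t = ∑' s, e s * ∫ p, dd s p ∂m}}
    have hle : ∀ e : S → ℝ, inE e → sInf {t | ∃ m : Measure ((∀ t, Xs t) × (∀ t, Xs t)),
        IsProbabilityMeasure m ∧ IsCoupling μ ν m ∧ t = ∑' s, e s * ∫ p, dd s p ∂m} ≤ c := by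
      intro e he
      refine le_csSup ⟨⨆ s, ∫ p, dd s p ∂(μ.prod ν), ?_⟩ ⟨e, he, rfl⟩
      rintro _ ⟨e', he', rfl⟩
      exact hweak e' he' _ hne.1 hne.2
    have hc0 : 0 ≤ c := by
      refine le_trans ?_ (hle 0 hzero)
      refine le_csInf ⟨_, _, hne.1, hne.2, rfl⟩ ?_
      rintro _ ⟨m, -, -, rfl⟩
      simp
    obtain ⟨_, ⟨m, hm, hmc, rfl⟩, hmle⟩ :=
      exists_forall_le_of_weighted_averages (by exact ⟨_, _, hne.1, hne.2, rfl⟩)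
        (isCompact_image_integral_dd hC μ ν) (convex_image_integral_dd hC μ ν) (c := c)
        fun e he b hb => by
          obtain ⟨_, ⟨m, hm, hmc, rfl⟩, hlt⟩ :=
            exists_lt_of_csInf_lt (by exact ⟨_, _, hne.1, hne.2, rfl⟩) ((hle e he).trans_lt hb)
          exact ⟨_, ⟨m, hm, hmc, rfl⟩, hlt⟩
    refine le_trans (csInf_le ⟨0, ?_⟩ ⟨m, hm, hmc, rfl⟩) (Real.iSup_le hmle hc0)
    rintro _ ⟨n, -, -, rfl⟩
    exact Real.iSup_nonneg (hnn n)
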